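/- Let p ≥ 7 be a prime and let K = ℚ(ζ_p + ζ_p⁻¹) be the maximal real subfield of the p-th cyclotomic field, a totally real field of degree (p−1)/2 over ℚ. There is no algebraic unit u in the ring of integers of K with u ≠ 1, ℚ(u) = K, u totally positive (all real embeddings of u are positive), and Tr_{K/ℚ}(u⁻¹) = (p+1)/2. -/

import Mathlib

open Real

/-- Smyth's auxiliary function inequality with the auxiliary polynomials `x` and `x - 1`. -/
lemma four_thirds_lt_sub_log {x : ℝ} (hx : 0 < x) (hx1 : x ≠ 1) :
    4 / 3 < x - 4 / 5 * Real.log x - 3 / 5 * Real.log (x - 1) := by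
  have l2 := Real.log_two_gt_d9
  have l2' := Real.log_two_lt_d9
  rcases hx1.lt_or_gt with h | h
  · have h1 : Real.log x + Real.log (5 / 4) + Real.log 2 ≤ 5 / 2 * x - 1 := by
      rw [← Real.log_mul hx.ne' (by norm_num), ← Real.log_mul (by positivity) (by norm_num)]
      refine (Real.log_le_sub_one_of_pos (by positivity)).trans (le_of_eq (by ring))
    have h2 : Real.log (x - 1) + Real.log (5 / 6) + Real.log 2 ≤ 5 / 3 * (1 - x) - 1 := by
      have h0 : 0 < 1 - x := by linarith
      rw [← Real.log_neg_eq_log (x - 1), neg_sub, ← Real.log_mul h0.ne' (by norm_num),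
        ← Real.log_mul (by positivity) (by norm_num)]
      refine (Real.log_le_sub_one_of_pos (by positivity)).trans (le_of_eq (by ring))
    have h3 := Real.one_sub_inv_le_log_of_pos (x := 5 / 4) (by norm_num)
    have h4 := Real.one_sub_inv_le_log_of_pos (x := 5 / 6) (by norm_num)
    norm_num at h3 h4
    linarith
  · have h1 : Real.log x - Real.log 2 ≤ x / 2 - 1 := by
      rw [← Real.log_div hx.ne' (by norm_num)]
      exact Real.log_le_sub_one_of_pos (by positivity)
    have h2 := Real.log_le_sub_one_of_pos (sub_pos.2 h)
    linarith

/-- The conjugates of a nonzero algebraic integer have a product of absolute value at least one. -/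
lemma sum_log_automorphisms_nonneg {K : Type*} [Field K] [CharZero K] [FiniteDimensional ℚ K]
    [IsGalois ℚ K] (φ : K →ₐ[ℚ] ℝ) {α : K} (hα : IsIntegral ℤ α) (h0 : α ≠ 0) :
    0 ≤ ∑ σ : K ≃ₐ[ℚ] K, Real.log (φ (σ α)) := by
  obtain ⟨n, hn⟩ := IsIntegrallyClosed.isIntegral_iff.1 (Algebra.isIntegral_norm ℚ hα)
  have hn0 : n ≠ 0 := by
    rintro rfl
    exact h0 ((Algebra.norm_eq_zero_iff (R := ℚ)).1 (by rw [← hn, map_zero]))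
  have hprod : ∏ σ : K ≃ₐ[ℚ] K, φ (σ α) = (n : ℝ) := by
    rw [← map_prod, ← Algebra.norm_eq_prod_automorphisms, ← hn]
    simp
  rw [← Real.log_prod fun σ _ ↦ by simpa using h0, hprod, ← Real.log_abs]
  exact Real.log_nonneg (by exact_mod_cast Int.one_le_abs hn0)

/-- A weak form of Siegel's trace bound for totally positive algebraic integers. -/
lemma four_thirds_mul_finrank_lt_trace {K : Type*} [Field K] [CharZero K] [FiniteDimensional ℚ K]
    [IsGalois ℚ K] (φ : K →ₐ[ℚ] ℝ) {α : K} (hα : IsIntegral ℤ α) (h1 : α ≠ 1)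
    (hpos : ∀ σ : K →ₐ[ℚ] ℝ, 0 < σ α) :
    (4 / 3 : ℝ) * Module.finrank ℚ K < Algebra.trace ℚ K α := by
  have h0 : α ≠ 0 := by
    rintro rfl
    simpa using hpos φ
  have htr : (Algebra.trace ℚ K α : ℝ) = ∑ σ : K ≃ₐ[ℚ] K, φ (σ α) := by
    rw [← map_sum, ← trace_eq_sum_automorphisms]
    simp
  have hlog := sum_log_automorphisms_nonneg φ hα h0
  have hlog1 := sum_log_automorphisms_nonneg φ (hα.sub isIntegral_one) (sub_ne_zero.2 h1)
  have hsum : ∑ _σ : K ≃ₐ[ℚ] K, (4 / 3 : ℝ) < ∑ σ : K ≃ₐ[ℚ] K,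
      (φ (σ α) - 4 / 5 * Real.log (φ (σ α)) - 3 / 5 * Real.log (φ (σ (α - 1)))) := by
    refine Finset.sum_lt_sum_of_nonempty Finset.univ_nonempty fun σ _ ↦ ?_
    rw [map_sub, map_sub, map_one, map_one]
    exact four_thirds_lt_sub_log (hpos (φ.comp (σ : K →ₐ[ℚ] K)))
      ((map_ne_one_iff φ φ.injective).2 ((map_ne_one_iff σ σ.injective).2 h1))
  rw [Finset.sum_const, Finset.card_univ, ← Nat.card_eq_fintype_card,
    IsGalois.card_aut_eq_finrank, nsmul_eq_mul, Finset.sum_sub_distrib, Finset.sum_sub_distrib,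
    ← Finset.mul_sum, ← Finset.mul_sum] at hsum
  rw [htr]
  linarith

open IntermediateField in
/-- A root of unity has degree at most two over a field containing its trace `ζ + ζ⁻¹`. -/
lemma totient_le_finrank_mul_two {k L : Type*} [Field k] [Field L] [Algebra k L] {n : ℕ}
    [NeZero n] {ζ : L} (hζ : IsPrimitiveRoot ζ n) (F : IntermediateField k L) [FiniteDimensional k F]
    (hn : Irreducible (Polynomial.cyclotomic n k)) (hF : ζ + ζ⁻¹ ∈ F) :
    n.totient ≤ Module.finrank k F * 2 := by
  have hζ0 : ζ ≠ 0 := hζ.ne_zero (NeZero.ne n)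
  let q : Polynomial F := .X ^ 2 - .C ⟨ζ + ζ⁻¹, hF⟩ * .X + .C 1
  have hqdeg : q.natDegree = 2 := by simp only [q]; compute_degree!
  have hqmonic : q.Monic := by simp only [q]; monicity!
  have hq : Polynomial.aeval ζ q = 0 := by
    simp only [q, map_add, map_sub, map_mul, map_pow, Polynomial.aeval_X, Polynomial.aeval_C,
      map_one, IntermediateField.algebraMap_apply]
    field_simp
    ring
  have hint : IsIntegral F ζ := ⟨q, hqmonic, hq⟩
  have := IntermediateField.adjoin.finiteDimensional hint
  have : Module.Free F F⟮ζ⟯ := Module.Free.of_divisionRing F F⟮ζ⟯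
  have : FiniteDimensional k F⟮ζ⟯ := .trans k F F⟮ζ⟯
  have hgen : IsPrimitiveRoot (AdjoinSimple.gen F ζ) n :=
    IsPrimitiveRoot.of_map_of_injective (f := algebraMap F⟮ζ⟯ L) (by simpa using hζ)
      (algebraMap F⟮ζ⟯ L).injective
  calc n.totient ≤ Module.finrank k F⟮ζ⟯ := by
        simpa using IsPrimitiveRoot.lcm_totient_le_finrank hgen hgen (by simpa using hn)
    _ = Module.finrank k F * Module.finrank F F⟮ζ⟯ := (Module.finrank_mul_finrank k F F⟮ζ⟯).symm
    _ ≤ Module.finrank k F * 2 := by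
        rw [adjoin.finrank hint, ← hqdeg]
        exact Nat.mul_le_mul_left _ (Polynomial.natDegree_le_natDegree (minpoly.min F ζ hqmonic hq))

open IntermediateField in
/-- Adjoining a primitive root of unity gives a finite abelian extension. -/
lemma isAbelianGalois_adjoin_primitiveRoot {k L : Type*} [Field k] [Field L] [Algebra k L] {n : ℕ}
    [NeZero n] {ζ : L} (hζ : IsPrimitiveRoot ζ n) :
    FiniteDimensional k k⟮ζ⟯ ∧ IsAbelianGalois k k⟮ζ⟯ := by
  have hint : IsIntegral k ζ := (hζ.isIntegral (NeZero.pos n)).tower_top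
  have : IsCyclotomicExtension {n} k k⟮ζ⟯ := by
    change IsCyclotomicExtension {n} k k⟮ζ⟯.toSubalgebra
    rw [adjoin_simple_toSubalgebra_of_isAlgebraic hint.isAlgebraic]
    exact hζ.adjoin_isCyclotomicExtension k
  exact ⟨adjoin.finiteDimensional hint, IsCyclotomicExtension.isAbelianGalois {n} k _⟩

open IntermediateField in
/-- The real cyclotomic field is Galois over the rationals of degree at least `φ(n) / 2`. -/
lemma adjoin_two_mul_cos_properties (n : ℕ) [NeZero n] :
    FiniteDimensional ℚ ℚ⟮2 * Real.cos (2 * π / n)⟯ ∧ IsGalois ℚ ℚ⟮2 * Real.cos (2 * π / n)⟯ ∧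
      n.totient ≤ Module.finrank ℚ ℚ⟮2 * Real.cos (2 * π / n)⟯ * 2 := by
  set c := 2 * Real.cos (2 * π / n) with hc
  set ζ := Complex.exp (2 * π * Complex.I / n) with hζdef
  have hζ : IsPrimitiveRoot ζ n := Complex.isPrimitiveRoot_exp n (NeZero.ne n)
  obtain ⟨hfinζ, habζ⟩ := isAbelianGalois_adjoin_primitiveRoot (k := ℚ) hζ
  have hsum : ζ + ζ⁻¹ = c := by
    rw [hc, hζdef, ← Complex.exp_neg]
    push_cast
    rw [Complex.two_cos]
    congr 2 <;> ring
  let ι : ℝ →ₐ[ℚ] ℂ := Complex.ofRealAm.restrictScalars ℚ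
  have hmap : ℚ⟮c⟯.map ι = ℚ⟮ζ + ζ⁻¹⟯ := by
    rw [adjoin_map, Set.image_singleton, hsum]
    rfl
  let e : ℚ⟮c⟯ ≃ₐ[ℚ] ℚ⟮ζ + ζ⁻¹⟯ := (equivMap _ ι).trans (equivOfEq hmap)
  have hle : ℚ⟮ζ + ζ⁻¹⟯ ≤ ℚ⟮ζ⟯ := by
    have h := mem_adjoin_simple_self ℚ ζ
    exact adjoin_simple_le_iff.2 (add_mem h (inv_mem h))
  let f : ℚ⟮c⟯ →ₐ[ℚ] ℚ⟮ζ⟯ := (inclusion hle).comp e.toAlgHom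
  have hfin : FiniteDimensional ℚ ℚ⟮c⟯ := .of_injective f.toLinearMap f.injective
  have : FiniteDimensional ℚ ℚ⟮ζ + ζ⁻¹⟯ := e.toLinearEquiv.finiteDimensional
  refine ⟨hfin, (@IsAbelianGalois.of_algHom _ _ _ _ _ _ _ _ f habζ).toIsGalois, ?_⟩
  rw [e.toLinearEquiv.finrank_eq]
  exact totient_le_finrank_mul_two hζ _
    (Polynomial.cyclotomic.irreducible_rat (NeZero.pos n)) (mem_adjoin_simple_self ℚ _)

/-- Let `p ≥ 7` be a prime and `K = ℚ(ζ_p + ζ_p⁻¹)` the maximal real subfield of the `p`-th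
cyclotomic field, realized as `ℚ(2·cos(2π/p)) ⊆ ℝ`. There is no totally positive algebraic
unit `u ≠ 1` in `K` generating `K` over `ℚ` with `Tr_{K/ℚ}(u⁻¹) = (p+1)/2`. -/
theorem no_totally_positive_unit_with_small_trace (p : ℕ) (hp : p.Prime) (h7 : 7 ≤ p)
    (K : IntermediateField ℚ ℝ)
    (hK : K = IntermediateField.adjoin ℚ ({2 * Real.cos (2 * π / p)} : Set ℝ)) :
    ¬ ∃ u : K, IsIntegral ℤ u ∧ IsIntegral ℤ u⁻¹ ∧ u ≠ 1 ∧
        IntermediateField.adjoin ℚ ({u} : Set K) = ⊤ ∧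
        (∀ σ : K →ₐ[ℚ] ℝ, 0 < σ u) ∧
        Algebra.trace ℚ K u⁻¹ = ((p : ℚ) + 1) / 2 := by
  rintro ⟨u, -, hint, h1, -, hpos, htr⟩
  have : NeZero p := ⟨hp.ne_zero⟩
  obtain ⟨hfin, hgal, hdeg⟩ := hK ▸ adjoin_two_mul_cos_properties p
  have hlt := four_thirds_mul_finrank_lt_trace (K.val : K →+* ℝ).toRatAlgHom hint (by simpa using h1)
    (fun σ ↦ by rw [map_inv₀]; exact inv_pos.2 (hpos σ))
  rw [htr] at hlt
  rw [Nat.totient_prime hp] at hdeg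
  have hdeg' : (p : ℝ) ≤ Module.finrank ℚ K * 2 + 1 := by exact_mod_cast (by omega)
  have h7' : (7 : ℝ) ≤ p := by exact_mod_cast h7
  push_cast at hlt
  linarith
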